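/- Let X_0,...,X_d be i.i.d. random points in ℝ^d distributed according to the beta' density f̃_{d,β} with β > d/2, and Δ_d the simplex volume. Then for every κ with 0 ≤ κ < 2β-d, E[Δ_d^κ] = (d!)^{-κ} · Γ((β-d/2)(d+1) - dκ/2)/Γ((β-(d+κ)/2)(d+1)) · (Γ(β-(d+κ)/2)/Γ(β-d/2))^{d+1} · ∏_{i=1}^d Γ((i+κ)/2)/Γ(i/2). -/

import Mathlib

open MeasureTheory

/-- Tonelli's theorem, separating the first of `n + 1` coordinates. -/
theorem lintegral_pi_fin_succ {n : ℕ} {E : Type*} [MeasurableSpace E] (μ : Measure E)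
    [SigmaFinite μ] {f : (Fin (n + 1) → E) → ENNReal} (hf : Measurable f) :
    ∫⁻ x, f x ∂(Measure.pi fun _ : Fin (n + 1) => μ) =
      ∫⁻ a, ∫⁻ y, f (Fin.cons a y) ∂(Measure.pi fun _ : Fin n => μ) ∂μ := by
  have h := (measurePreserving_piFinSuccAbove (fun _ : Fin (n + 1) => μ) 0).symm
  rw [h.lintegral_map_equiv f, lintegral_prod]
  · simp [MeasurableEquiv.piFinSuccAbove_symm_apply, Fin.insertNthEquiv, Fin.insertNth_zero']
  · exact (hf.comp (MeasurableEquiv.measurable _)).aemeasurable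

theorem measurable_fin_cons {n : ℕ} {E : Type*} [MeasurableSpace E] :
    Measurable fun p : E × (Fin n → E) => (Fin.cons p.1 p.2 : Fin (n + 1) → E) :=
  measurable_pi_iff.2 <| Fin.cases (by simpa using measurable_fst) fun i => by
    simp only [Fin.cons_succ]
    fun_prop

theorem lintegral_pi_fin_prod {n : ℕ} {E : Type*} [MeasurableSpace E] (μ : Measure E)
    [SigmaFinite μ] {f : Fin n → E → ENNReal} (hf : ∀ i, Measurable (f i)) :
    ∫⁻ x, ∏ i, f i (x i) ∂(Measure.pi fun _ : Fin n => μ) = ∏ i, ∫⁻ a, f i a ∂μ := by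
  induction n with
  | zero => simp
  | succ n ih =>
    rw [lintegral_pi_fin_succ μ (by fun_prop), Fin.prod_univ_succ, ← ih fun i => hf i.succ,
      ← lintegral_mul_const _ (hf 0)]
    simp_rw [Fin.prod_univ_succ, Fin.cons_zero, Fin.cons_succ]
    refine lintegral_congr fun a => ?_
    rw [lintegral_const_mul _ (by fun_prop)]

/-- Swapping the two indices preserves Lebesgue measure on matrices. -/
theorem measurePreserving_swap_index (m n : ℕ) :
    MeasurePreserving (fun (A : Fin m → Fin n → ℝ) (j : Fin n) (i : Fin m) => A i j) := by
  let e : (Fin m → Fin n → ℝ) ≃L[ℝ] (Fin n → Fin m → ℝ) :=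
    LinearEquiv.toContinuousLinearEquiv
      { toFun := fun A j i => A i j
        invFun := fun A j i => A i j
        map_add' := fun _ _ => rfl
        map_smul' := fun _ _ => rfl
        left_inv := fun _ => rfl
        right_inv := fun _ => rfl }
  refine ⟨e.continuous.measurable, ?_⟩
  have : (Measure.map e volume).IsAddHaarMeasure := e.isAddHaarMeasure_map _
  have hvol (p q : ℕ) :
      (volume : Measure (Fin p → Fin q → ℝ)) (Set.univ.pi fun _ => Set.univ.pi fun _ => Set.Icc 0 1)
        = 1 := by
    simp_rw [volume_pi_pi]
    simp
  have : (volume : Measure (Fin n → Fin m → ℝ)).IsAddHaarMeasure := Measure.pi.isAddHaarMeasure _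
  have hc := Measure.isAddLeftInvariant_eq_smul (Measure.map e volume)
    (volume : Measure (Fin n → Fin m → ℝ))
  generalize Measure.addHaarScalarFactor (Measure.map e volume)
    (volume : Measure (Fin n → Fin m → ℝ)) = c at hc
  have h1 := congrArg
    (fun μ => μ (Set.univ.pi fun _ => Set.univ.pi fun _ => Set.Icc (0 : ℝ) 1)) hc
  beta_reduce at h1
  rw [Measure.smul_apply, hvol, Measure.map_apply e.continuous.measurable
    (.univ_pi fun _ => .univ_pi fun _ => measurableSet_Icc)] at h1
  have h2 : e ⁻¹' (Set.univ.pi fun _ => Set.univ.pi fun _ => Set.Icc (0 : ℝ) 1) =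
      Set.univ.pi fun _ => Set.univ.pi fun _ => Set.Icc (0 : ℝ) 1 := by
    ext A
    simp only [Set.mem_preimage, Set.mem_univ_pi]
    exact forall_comm
  rw [h2, hvol, ENNReal.smul_def, smul_eq_mul, mul_one, eq_comm, ENNReal.coe_eq_one] at h1
  rw [h1, one_smul] at hc
  exact hc

theorem lintegral_swap_index {m n : ℕ} {F : (Fin m → Fin n → ℝ) → ENNReal} (hF : Measurable F) :
    ∫⁻ A : Fin n → Fin m → ℝ, F (fun i j => A j i) = ∫⁻ A, F A :=
  (measurePreserving_swap_index n m).lintegral_comp hF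

/-- Change of variables for a linear map acting simultaneously on `n` vectors. -/
theorem lintegral_comp_mulVec {m n : ℕ} {P : Matrix (Fin m) (Fin m) ℝ} (hP : P.det ≠ 0)
    {F : (Fin n → Fin m → ℝ) → ENNReal} (hF : Measurable F) :
    ∫⁻ A : Fin n → Fin m → ℝ, F (fun j => P.mulVec (A j)) =
      ENNReal.ofReal (|P.det|⁻¹ ^ n) * ∫⁻ A, F A := by
  let L : (Fin n → Fin m → ℝ) →ₗ[ℝ] (Fin n → Fin m → ℝ) :=
    LinearMap.pi fun j => (Matrix.toLin' P).comp (LinearMap.proj j)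
  have hL : LinearMap.det L = P.det ^ n := by
    simp [L, LinearMap.det_pi]
  have h := Measure.map_linearMap_addHaar_eq_smul_addHaar
    (volume : Measure (Fin n → Fin m → ℝ)) (f := L) (by rw [hL]; exact pow_ne_zero _ hP)
  have h2 := lintegral_map (μ := volume) hF L.continuous_of_finiteDimensional.measurable
  rw [h, lintegral_smul_measure, hL] at h2
  rw [← inv_pow, abs_pow, abs_inv] at h2
  exact h2.symm

/-- Rescaling the variable in an integral over the positive half-line. -/
theorem setLIntegral_Ioi_comp_mul {c : ℝ} (hc : 0 < c) {g : ℝ → ENNReal} (hg : Measurable g) :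
    ENNReal.ofReal c * ∫⁻ x in Set.Ioi 0, g (c * x) = ∫⁻ x in Set.Ioi 0, g x := by
  have h := Real.smul_map_volume_mul_left hc.ne'
  conv_rhs => rw [← h, Measure.restrict_smul, lintegral_smul_measure,
    Measure.restrict_map (measurable_const_mul c) measurableSet_Ioi,
    lintegral_map hg (measurable_const_mul c)]
  rw [abs_of_pos hc, smul_eq_mul]
  congr 3
  ext x
  simp [hc]

/-- The two-variable Dirichlet integral, up to a multiplicative constant. -/
theorem exists_lintegral_rpow_mul_rpow_mul (a b : ℝ) :
    ∃ C : ENNReal, ∀ h : ℝ → ENNReal, Measurable h →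
      ∫⁻ x in Set.Ioi 0, ∫⁻ y in Set.Ioi 0,
        ENNReal.ofReal (x ^ (a - 1)) * ENNReal.ofReal (y ^ (b - 1)) * h (x + y) =
      C * ∫⁻ z in Set.Ioi 0, ENNReal.ofReal (z ^ (a + b - 1)) * h z := by
  refine ⟨∫⁻ w in Set.Ioi 0, ENNReal.ofReal (w ^ (b - 1) * (1 + w) ^ (-(a + b))),
    fun h hh => ?_⟩
  calc
    _ = ∫⁻ x in Set.Ioi (0 : ℝ), ∫⁻ w in Set.Ioi (0 : ℝ),
        ENNReal.ofReal (x ^ (a + b - 1) * w ^ (b - 1)) * h ((1 + w) * x) := by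
      refine setLIntegral_congr_fun measurableSet_Ioi fun x (hx : 0 < x) => ?_
      rw [← setLIntegral_Ioi_comp_mul hx (by fun_prop), ← lintegral_const_mul _ (by fun_prop)]
      refine setLIntegral_congr_fun measurableSet_Ioi fun w (hw : 0 < w) => ?_
      rw [← ENNReal.ofReal_mul (by positivity), ← mul_assoc, ← ENNReal.ofReal_mul (by positivity)]
      congr 2
      · rw [Real.mul_rpow hx.le hw.le, show a + b - 1 = 1 + (a - 1) + (b - 1) by ring,
          Real.rpow_add hx, Real.rpow_add hx, Real.rpow_one]
        ring
      · ring
    _ = ∫⁻ w in Set.Ioi (0 : ℝ), ∫⁻ x in Set.Ioi (0 : ℝ),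
        ENNReal.ofReal (x ^ (a + b - 1) * w ^ (b - 1)) * h ((1 + w) * x) :=
      lintegral_lintegral_swap (by fun_prop)
    _ = _ := by
      rw [← lintegral_mul_const _ (by fun_prop)]
      refine setLIntegral_congr_fun measurableSet_Ioi fun w (hw : 0 < w) => ?_
      have hw1 : 0 < 1 + w := by positivity
      rw [← setLIntegral_Ioi_comp_mul hw1 (g := fun z => ENNReal.ofReal (z ^ (a + b - 1)) * h z)
        (by fun_prop), ← mul_assoc, ← lintegral_const_mul _ (by fun_prop)]
      refine setLIntegral_congr_fun measurableSet_Ioi fun x (hx : 0 < x) => ?_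
      rw [← mul_assoc, ← ENNReal.ofReal_mul (by positivity), ← ENNReal.ofReal_mul (by positivity)]
      congr 2
      rw [Real.mul_rpow hw1.le hx.le, Real.rpow_sub hw1, Real.rpow_neg hw1.le, Real.rpow_one]
      have := (Real.rpow_pos_of_pos hw1 (a + b)).ne'
      field_simp

/-- The Dirichlet integral, up to a multiplicative constant. -/
theorem exists_lintegral_pi_prod_rpow_mul (a : ℝ) (n : ℕ) :
    ∃ C : ENNReal, ∀ h : ℝ → ENNReal, Measurable h →
      ∫⁻ t, (∏ i, ENNReal.ofReal (t i ^ (a - 1))) * h (∑ i, t i)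
        ∂(Measure.pi fun _ : Fin (n + 1) => volume.restrict (Set.Ioi (0 : ℝ))) =
      C * ∫⁻ z in Set.Ioi 0, ENNReal.ofReal (z ^ ((n + 1) * a - 1)) * h z := by
  induction n with
  | zero =>
    refine ⟨1, fun h hh => ?_⟩
    rw [lintegral_pi_fin_succ _ (by fun_prop)]
    simp
  | succ n ih =>
    obtain ⟨C, hC⟩ := ih
    obtain ⟨C', hC'⟩ := exists_lintegral_rpow_mul_rpow_mul a ((n + 1) * a)
    refine ⟨C * C', fun h hh => ?_⟩
    rw [lintegral_pi_fin_succ _ (by fun_prop), mul_assoc,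
      show ((n + 1 : ℕ) + 1) * a - 1 = a + (n + 1) * a - 1 by push_cast; ring, ← hC' h hh,
      ← lintegral_const_mul _ (by fun_prop)]
    refine lintegral_congr fun x => ?_
    simp_rw [Fin.prod_univ_succ (n := n + 1), Fin.sum_univ_succ (n := n + 1), Fin.cons_zero,
      Fin.cons_succ, mul_assoc]
    rw [lintegral_const_mul _ (by fun_prop), hC (fun s => h (x + s)) (by fun_prop),
      lintegral_const_mul _ (by fun_prop), mul_left_comm]

theorem lintegral_rpow_mul_exp_neg_mul {a r : ℝ} (ha : 0 < a) (hr : 0 < r) :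
    ∫⁻ t in Set.Ioi 0, ENNReal.ofReal (t ^ (a - 1) * Real.exp (-(r * t))) =
      ENNReal.ofReal (r ^ (-a) * Real.Gamma a) := by
  have h := Real.integral_rpow_mul_exp_neg_mul_Ioi ha hr
  have hpos : 0 < (1 / r) ^ a * Real.Gamma a := by positivity
  rw [← ofReal_integral_eq_lintegral_ofReal (.of_integral_ne_zero (h ▸ hpos.ne')), h,
    Real.rpow_neg hr.le, one_div, Real.inv_rpow hr.le]
  filter_upwards [ae_restrict_mem measurableSet_Ioi] with t (ht : 0 < t)
  positivity

/-- Moments of a sum of independent gamma variables. -/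
theorem lintegral_pi_prod_rpow_exp_mul_sum_rpow {a s : ℝ} (ha : 0 < a) (hs : 0 ≤ s) (n : ℕ) :
    ∫⁻ t, (∏ i, ENNReal.ofReal (t i ^ (a - 1) * Real.exp (-t i))) *
        ENNReal.ofReal ((∑ i, t i) ^ s)
        ∂(Measure.pi fun _ : Fin (n + 1) => volume.restrict (Set.Ioi (0 : ℝ))) =
      ENNReal.ofReal (Real.Gamma a ^ (n + 1) * Real.Gamma ((n + 1) * a + s) /
        Real.Gamma ((n + 1) * a)) := by
  obtain ⟨C, hC⟩ := exists_lintegral_pi_prod_rpow_mul a n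
  have key (s : ℝ) (hs : 0 ≤ s) :
      ∫⁻ t, (∏ i, ENNReal.ofReal (t i ^ (a - 1) * Real.exp (-t i))) *
        ENNReal.ofReal ((∑ i, t i) ^ s)
        ∂(Measure.pi fun _ : Fin (n + 1) => volume.restrict (Set.Ioi (0 : ℝ))) =
      C * ENNReal.ofReal (Real.Gamma ((n + 1) * a + s)) := by
    have h0 := lintegral_rpow_mul_exp_neg_mul (a := (n + 1) * a + s) (r := 1) (by positivity)
      one_pos
    simp only [one_mul, Real.one_rpow] at h0
    have h1 := hC (fun z => ENNReal.ofReal (z ^ s * Real.exp (-z))) (by fun_prop)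
    rw [← h0]
    refine Eq.trans (lintegral_congr fun t => ?_) (h1.trans ?_)
    · rw [ENNReal.ofReal_mul' (Real.exp_nonneg _), ← Finset.sum_neg_distrib, Real.exp_sum,
        ENNReal.ofReal_prod_of_nonneg fun _ _ => Real.exp_nonneg _]
      simp_rw [ENNReal.ofReal_mul' (Real.exp_nonneg _), Finset.prod_mul_distrib]
      ring
    · congr 1
      refine setLIntegral_congr_fun measurableSet_Ioi fun x (hx : 0 < x) => ?_
      rw [← ENNReal.ofReal_mul (by positivity), ← mul_assoc, ← Real.rpow_add hx]
      ring_nf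
  have hG : 0 < Real.Gamma ((n + 1) * a) := by positivity
  have h0 := key 0 le_rfl
  have h1 := lintegral_rpow_mul_exp_neg_mul ha one_pos
  simp only [one_mul, Real.one_rpow] at h1
  simp only [Real.rpow_zero, ENNReal.ofReal_one, mul_one, add_zero] at h0
  rw [lintegral_pi_fin_prod (n := n + 1) (volume.restrict (Set.Ioi (0 : ℝ)))
    (f := fun _ x => ENNReal.ofReal (x ^ (a - 1) * Real.exp (-x))) (fun _ => by fun_prop), h1,
    Finset.prod_const, Finset.card_univ, Fintype.card_fin] at h0
  rw [key s hs, mul_div_right_comm, ENNReal.ofReal_mul (by positivity),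
    ENNReal.ofReal_div_of_pos hG, ENNReal.ofReal_pow (by positivity), h0,
    ENNReal.mul_div_cancel_right (by simpa using hG) ENNReal.ofReal_ne_top]

/-- The unnormalized Gaussian density `exp (-‖v‖²)`. -/
noncomputable def gaussianWeight {n : ℕ} (v : Fin n → ℝ) : ENNReal :=
  ENNReal.ofReal (Real.exp (-(v ⬝ᵥ v)))

@[fun_prop]
theorem measurable_gaussianWeight {n : ℕ} :
    Measurable (gaussianWeight : (Fin n → ℝ) → ENNReal) := by
  unfold gaussianWeight dotProduct
  fun_prop

theorem prod_gaussianWeight {m n : ℕ} (A : Fin m → Fin n → ℝ) :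
    ∏ i, gaussianWeight (A i) = ENNReal.ofReal (Real.exp (-∑ i, ∑ j, A i j ^ 2)) := by
  simp_rw [gaussianWeight, dotProduct, ← pow_two]
  rw [← ENNReal.ofReal_prod_of_nonneg fun _ _ => Real.exp_nonneg _, ← Real.exp_sum,
    Finset.sum_neg_distrib]

theorem prod_gaussianWeight_swap {m n : ℕ} (A : Fin m → Fin n → ℝ) :
    ∏ j, gaussianWeight (fun i => A i j) = ∏ i, gaussianWeight (A i) := by
  rw [prod_gaussianWeight, prod_gaussianWeight A, Finset.sum_comm]

theorem measurable_abs_det_rpow {α : Type*} [MeasurableSpace α] {n : ℕ}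
    {M : α → Fin n → Fin n → ℝ} (hM : Measurable M) (κ : ℝ) :
    Measurable fun a => ENNReal.ofReal (|(Matrix.of (M a)).det| ^ κ) := by
  have h : Measurable fun A : Fin n → Fin n → ℝ => (Matrix.of A).det := by
    simp only [Matrix.det_apply, Matrix.of_apply]
    fun_prop
  have := h.comp hM
  simp only [Function.comp_def] at this
  fun_prop

theorem lintegral_norm_rpow_mul_gaussianWeight {m : ℕ} (hm : 1 ≤ m) {κ : ℝ} (hκ : 0 ≤ κ) :
    ∫⁻ u : Fin m → ℝ, ENNReal.ofReal (Real.sqrt (u ⬝ᵥ u) ^ κ) * gaussianWeight u =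
      ENNReal.ofReal (Real.sqrt Real.pi ^ m *
        (Real.Gamma ((m + κ) / 2) / Real.Gamma (m / 2))) := by
  have hm0 : (0 : ℝ) < m := by exact_mod_cast hm
  have : Nonempty (Fin m) := ⟨⟨0, hm⟩⟩
  rw [← (PiLp.volume_preserving_ofLp (Fin m)).lintegral_comp
    (by unfold dotProduct; fun_prop)]
  have hnorm (x : EuclideanSpace ℝ (Fin m)) : x.ofLp ⬝ᵥ x.ofLp = ‖x‖ ^ 2 := by
    simp [EuclideanSpace.real_norm_sq_eq, dotProduct, ← pow_two]
  have hrad := integral_fun_norm_addHaar (volume : Measure (EuclideanSpace ℝ (Fin m)))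
    fun y => y ^ κ * Real.exp (-y ^ (2 : ℝ))
  have hint : ∫ y in Set.Ioi (0 : ℝ), y ^ (m - 1) • (y ^ κ * Real.exp (-y ^ (2 : ℝ))) =
      1 / 2 * Real.Gamma ((m + κ) / 2) := by
    rw [show (m + κ : ℝ) = m - 1 + κ + 1 by ring,
      ← integral_rpow_mul_exp_neg_rpow two_pos (by linarith : -1 < (m - 1 + κ : ℝ))]
    refine setIntegral_congr_fun measurableSet_Ioi fun y (hy : 0 < y) => ?_
    rw [smul_eq_mul, Real.rpow_add hy, ← Real.rpow_natCast, Nat.cast_sub hm, Nat.cast_one]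
    ring
  have hvol : (volume : Measure (EuclideanSpace ℝ (Fin m))).real (Metric.ball 0 1) =
      Real.sqrt Real.pi ^ m / (m / 2 * Real.Gamma (m / 2)) := by
    rw [Measure.real, EuclideanSpace.volume_ball, Real.Gamma_add_one (by positivity),
      Fintype.card_fin]
    simp only [ENNReal.ofReal_one, one_pow, one_mul]
    exact ENNReal.toReal_ofReal (by positivity)
  rw [finrank_euclideanSpace_fin, hint, hvol] at hrad
  have hval : m • (Real.sqrt Real.pi ^ m / (m / 2 * Real.Gamma (m / 2))) •
      (1 / 2 * Real.Gamma ((m + κ) / 2)) = Real.sqrt Real.pi ^ m *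
        (Real.Gamma ((m + κ) / 2) / Real.Gamma (m / 2)) := by
    rw [nsmul_eq_mul, smul_eq_mul]
    have : 0 < Real.Gamma ((m : ℝ) / 2) := by positivity
    field_simp
  rw [hval] at hrad
  have hpos : 0 < Real.sqrt Real.pi ^ m *
        (Real.Gamma ((m + κ) / 2) / Real.Gamma (m / 2)) := by positivity
  rw [← hrad, ofReal_integral_eq_lintegral_ofReal (.of_integral_ne_zero (hrad ▸ hpos.ne'))
    (.of_forall fun x => by positivity)]
  refine lintegral_congr fun x => ?_
  rw [gaussianWeight, hnorm, Real.sqrt_sq (norm_nonneg x), ← ENNReal.ofReal_mul (by positivity),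
    Real.rpow_two]

theorem lintegral_gaussianWeight (n : ℕ) :
    ∫⁻ u : Fin n → ℝ, gaussianWeight u = ENNReal.ofReal (Real.sqrt Real.pi ^ n) := by
  rcases Nat.eq_zero_or_pos n with rfl | hn
  · simp [gaussianWeight, volume_pi]
  · have h := lintegral_norm_rpow_mul_gaussianWeight hn le_rfl
    have : (0 : ℝ) < Real.Gamma (n / 2) := by positivity
    simpa [div_self this.ne'] using h

/-- The `κ`-th absolute moment of the determinant against the Gaussian weight. -/
noncomputable def gaussianDetMoment (n : ℕ) (κ : ℝ) : ENNReal :=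
  ∫⁻ A : Fin n → Fin n → ℝ,
    ENNReal.ofReal (|(Matrix.of A).det| ^ κ) * ∏ i, gaussianWeight (A i)

theorem det_of_cons_single {n : ℕ} (r : ℝ) (A : Fin n → Fin (n + 1) → ℝ) :
    (Matrix.of (Fin.cons (Pi.single 0 r) A : Fin (n + 1) → Fin (n + 1) → ℝ)).det =
      r * (Matrix.of fun i j => A i (Fin.succ j)).det := by
  rw [Matrix.det_succ_row_zero, Fin.sum_univ_succ]
  simp [Matrix.submatrix]

theorem measurable_cons_const {α : Type*} [MeasurableSpace α] {n : ℕ} (u : α) :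
    Measurable fun A : Fin n → α => (Fin.cons u A : Fin (n + 1) → α) :=
  measurable_fin_cons.comp measurable_prodMk_left

theorem lintegral_det_cons_single (n : ℕ) (κ : ℝ) {r : ℝ} (hr : 0 ≤ r) :
    ∫⁻ A : Fin n → Fin (n + 1) → ℝ,
      ENNReal.ofReal (|(Matrix.of (Fin.cons (Pi.single 0 r) A :
        Fin (n + 1) → Fin (n + 1) → ℝ)).det| ^ κ) * ∏ j, gaussianWeight (A j) =
      ENNReal.ofReal (r ^ κ) *
        (ENNReal.ofReal (Real.sqrt Real.pi ^ n) * gaussianDetMoment n κ) := by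
  have hm : Measurable fun A : Fin n → Fin (n + 1) → ℝ =>
      ENNReal.ofReal (|(Matrix.of (Fin.cons (Pi.single 0 r) A :
        Fin (n + 1) → Fin (n + 1) → ℝ)).det| ^ κ) * ∏ j, gaussianWeight (A j) :=
    (measurable_abs_det_rpow (measurable_cons_const _) κ).mul (by fun_prop)
  have hJ : Measurable fun A : Fin n → Fin n → ℝ =>
      ENNReal.ofReal (|(Matrix.of A).det| ^ κ) * ∏ j, gaussianWeight (A j) :=
    (measurable_abs_det_rpow measurable_id κ).mul (by fun_prop)
  have hG : Measurable fun B : Fin (n + 1) → Fin n → ℝ =>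
      ENNReal.ofReal (r ^ κ) * (gaussianWeight (B 0) *
        (ENNReal.ofReal (|(Matrix.of fun i => B (Fin.succ i)).det| ^ κ) *
          ∏ i : Fin n, gaussianWeight (B i.succ))) :=
    ((measurable_gaussianWeight.comp (measurable_pi_apply 0)).mul
      (hJ.comp (measurable_pi_lambda _ fun i => measurable_pi_apply (Fin.succ i)))).const_mul _
  rw [← lintegral_swap_index hm]
  calc
    _ = ∫⁻ B : Fin (n + 1) → Fin n → ℝ, ENNReal.ofReal (r ^ κ) * (gaussianWeight (B 0) *
        (ENNReal.ofReal (|(Matrix.of fun i => B (Fin.succ i)).det| ^ κ) *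
          ∏ i : Fin n, gaussianWeight (B i.succ))) := by
      refine lintegral_congr fun B => ?_
      rw [det_of_cons_single, prod_gaussianWeight_swap, Fin.prod_univ_succ, abs_mul,
        abs_of_nonneg hr, Real.mul_rpow hr (abs_nonneg _), ENNReal.ofReal_mul (by positivity),
        ← Matrix.det_transpose]
      simp only [mul_assoc, mul_left_comm]
      rfl
    _ = _ := by
      rw [volume_pi, lintegral_pi_fin_succ _ hG, ← lintegral_gaussianWeight, gaussianDetMoment]
      simp_rw [Fin.cons_zero, Fin.cons_succ]
      rw [← lintegral_mul_const _ (by fun_prop), ← lintegral_const_mul _ (by fun_prop)]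
      refine lintegral_congr fun b => ?_
      rw [lintegral_const_mul _ (hJ.const_mul _), lintegral_const_mul _ hJ]
      rfl

/-- Every vector is rotated onto the first coordinate axis by some orthogonal matrix. -/
theorem exists_orthogonal_mulVec_eq_single {n : ℕ} (u : Fin (n + 1) → ℝ) :
    ∃ P : Matrix (Fin (n + 1)) (Fin (n + 1)) ℝ,
      P * P.transpose = 1 ∧ P.mulVec u = Pi.single 0 (Real.sqrt (u ⬝ᵥ u)) := by
  by_cases hu : u = 0
  · exact ⟨1, by simp [hu]⟩
  let x : EuclideanSpace ℝ (Fin (n + 1)) := WithLp.toLp 2 u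
  have hx : x ≠ 0 := fun h => hu (congrArg WithLp.ofLp h)
  have hnorm : ‖x‖ = Real.sqrt (u ⬝ᵥ u) := by
    simp [x, EuclideanSpace.norm_eq, dotProduct, pow_two]
  have horth : Orthonormal ℝ (({0} : Set (Fin (n + 1))).domRestrict
      fun _ => (‖x‖⁻¹ : ℝ) • x) := by
    refine ⟨fun i => ?_, fun i j hij => (hij (Subsingleton.elim i j)).elim⟩
    simp [norm_smul, hx]
  obtain ⟨b, hb⟩ := horth.exists_orthonormalBasis_extension_of_card_eq (by simp)
  have hb0 := hb 0 rfl
  have hinner (v w : EuclideanSpace ℝ (Fin (n + 1))) : v.ofLp ⬝ᵥ w.ofLp = inner ℝ v w := by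
    rw [EuclideanSpace.inner_eq_star_dotProduct, dotProduct_comm]
    simp
  refine ⟨Matrix.of fun i j => b i j, ?_, ?_⟩
  · ext i j
    rw [Matrix.mul_apply_eq_vecMul]
    change (b i).ofLp ⬝ᵥ (b j).ofLp = _
    rw [hinner, orthonormal_iff_ite.1 b.orthonormal, Matrix.one_apply]
  · ext i
    change (b i).ofLp ⬝ᵥ x.ofLp = _
    have hxb : x = ‖x‖ • b 0 := by
      rw [hb0, smul_smul, mul_inv_cancel₀ (norm_ne_zero_iff.2 hx), one_smul]
    rw [hinner, ← hnorm]
    conv_lhs => rw [hxb]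
    rw [inner_smul_right, orthonormal_iff_ite.1 b.orthonormal, Pi.single_apply]
    simp

theorem lintegral_det_cons (n : ℕ) (κ : ℝ) (u : Fin (n + 1) → ℝ) :
    ∫⁻ A : Fin n → Fin (n + 1) → ℝ,
      ENNReal.ofReal (|(Matrix.of (Fin.cons u A : Fin (n + 1) → Fin (n + 1) → ℝ)).det| ^ κ) *
        ∏ j, gaussianWeight (A j) =
      ENNReal.ofReal (Real.sqrt (u ⬝ᵥ u) ^ κ) *
        (ENNReal.ofReal (Real.sqrt Real.pi ^ n) * gaussianDetMoment n κ) := by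
  obtain ⟨P, hP, hPu⟩ := exists_orthogonal_mulVec_eq_single u
  have hdet : |P.det| = 1 := by
    have h := congrArg Matrix.det hP
    rw [Matrix.det_mul, Matrix.det_transpose, Matrix.det_one, ← pow_two] at h
    rwa [← pow_eq_one_iff_of_nonneg (abs_nonneg _) two_ne_zero, sq_abs]
  have hm : Measurable fun A : Fin n → Fin (n + 1) → ℝ =>
      ENNReal.ofReal (|(Matrix.of (Fin.cons (P.mulVec u) A :
        Fin (n + 1) → Fin (n + 1) → ℝ)).det| ^ κ) * ∏ j, gaussianWeight (A j) :=
    (measurable_abs_det_rpow (measurable_cons_const _) κ).mul (by fun_prop)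
  have h := lintegral_comp_mulVec (P := P) (by intro h; simp [h] at hdet) hm
  rw [hdet, inv_one, one_pow, ENNReal.ofReal_one, one_mul] at h
  rw [← lintegral_det_cons_single n κ (Real.sqrt_nonneg _), ← hPu, ← h]
  refine lintegral_congr fun A => ?_
  congr 1
  · have hmul : (Matrix.of (Fin.cons (P.mulVec u) fun j => P.mulVec (A j) :
        Fin (n + 1) → Fin (n + 1) → ℝ)) =
        (Matrix.of (Fin.cons u A : Fin (n + 1) → Fin (n + 1) → ℝ)) * P.transpose := by
      ext i j
      refine Fin.cases ?_ (fun i => ?_) i <;>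
        simp [Matrix.mul_apply, Matrix.mulVec, dotProduct, mul_comm]
    rw [hmul, Matrix.det_mul, Matrix.det_transpose, abs_mul, hdet, mul_one]
  · refine Finset.prod_congr rfl fun j _ => ?_
    rw [gaussianWeight, gaussianWeight, Matrix.dotProduct_mulVec, Matrix.vecMul_mulVec,
      mul_eq_one_comm.1 hP, Matrix.vecMul_one]

theorem gaussianDetMoment_eq (n : ℕ) {κ : ℝ} (hκ : 0 ≤ κ) :
    gaussianDetMoment n κ = ENNReal.ofReal (Real.sqrt Real.pi ^ (n * n) *
      ∏ i ∈ Finset.Icc 1 n, Real.Gamma ((i + κ) / 2) / Real.Gamma ((i : ℝ) / 2)) := by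
  induction n with
  | zero => simp [gaussianDetMoment, volume_pi]
  | succ n ih =>
    have hm : Measurable fun A : Fin (n + 1) → Fin (n + 1) → ℝ =>
        ENNReal.ofReal (|(Matrix.of A).det| ^ κ) * ∏ j, gaussianWeight (A j) :=
      (measurable_abs_det_rpow measurable_id κ).mul (by fun_prop)
    rw [gaussianDetMoment, volume_pi, lintegral_pi_fin_succ _ hm]
    have hstep (u : Fin (n + 1) → ℝ) :
        ∫⁻ A : Fin n → Fin (n + 1) → ℝ,
          ENNReal.ofReal (|(Matrix.of (Fin.cons u A : Fin (n + 1) → Fin (n + 1) → ℝ)).det| ^ κ) *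
            ∏ j, gaussianWeight ((Fin.cons u A : Fin (n + 1) → Fin (n + 1) → ℝ) j) =
        ENNReal.ofReal (Real.sqrt (u ⬝ᵥ u) ^ κ) * gaussianWeight u *
          (ENNReal.ofReal (Real.sqrt Real.pi ^ n) * gaussianDetMoment n κ) := by
      rw [mul_right_comm, ← lintegral_det_cons, ← lintegral_mul_const]
      · refine lintegral_congr fun A => ?_
        rw [Fin.prod_univ_succ, Fin.cons_zero]
        simp_rw [Fin.cons_succ]
        ring
      · exact (measurable_abs_det_rpow (measurable_cons_const _) κ).mul (by fun_prop)
    refine (lintegral_congr hstep).trans ?_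
    rw [lintegral_mul_const _ (by unfold dotProduct; fun_prop)]
    have hN := lintegral_norm_rpow_mul_gaussianWeight (Nat.le_add_left 1 n) hκ
    rw [hN, ih, ← ENNReal.ofReal_mul (by positivity), ← ENNReal.ofReal_mul (by positivity),
      Finset.prod_Icc_succ_top (Nat.le_add_left 1 n)]
    congr 1
    ring

theorem det_of_cons_one {n : ℕ} (A : Fin n → Fin (n + 1) → ℝ) :
    (Matrix.of (Fin.cons 1 A : Fin (n + 1) → Fin (n + 1) → ℝ)).det =
      (Matrix.of fun i j : Fin n => A j i.succ - A j 0).det := by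
  let N : Matrix (Fin (n + 1)) (Fin (n + 1)) ℝ :=
    (Matrix.of (Fin.cons 1 A : Fin (n + 1) → Fin (n + 1) → ℝ)).transpose
  let B : Matrix (Fin (n + 1)) (Fin (n + 1)) ℝ :=
    Matrix.of (Fin.cons (N 0) fun i => N i.succ - N 0)
  have hNB : N.det = B.det :=
    Matrix.det_eq_of_forall_row_eq_smul_add_const (Fin.cons 0 1) 0 rfl fun i j => by
      refine Fin.cases ?_ (fun i => ?_) i <;> simp [B]
  rw [← Matrix.det_transpose]
  change N.det = _
  rw [hNB, Matrix.det_succ_column_zero, Fin.sum_univ_succ]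
  simp [B, N, Matrix.submatrix]

theorem lintegral_simplex_det {d : ℕ} {κ : ℝ} {t : Fin (d + 1) → ℝ} (ht : ∀ i, 0 < t i) :
    ∫⁻ X : Fin (d + 1) → Fin d → ℝ,
      ENNReal.ofReal (|(Matrix.of fun i j : Fin d => X i.succ j - X 0 j).det| ^ κ) *
        ∏ i, ENNReal.ofReal (Real.exp (-(t i * (X i ⬝ᵥ X i)))) =
      (∏ i, ENNReal.ofReal (t i ^ (-((d + κ) / 2)))) * ENNReal.ofReal ((∑ i, t i) ^ (κ / 2)) *
        (ENNReal.ofReal (Real.sqrt Real.pi ^ d) * gaussianDetMoment d κ) := by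
  let s : Fin (d + 1) → ℝ := fun i => Real.sqrt (t i)
  have hs i : 0 < s i := Real.sqrt_pos.2 (ht i)
  have hsprod : 0 < ∏ i, s i := Finset.prod_pos fun i _ => hs i
  have hPdet : (Matrix.diagonal s).det = ∏ i, s i := Matrix.det_diagonal
  have hmX : Measurable fun X : Fin (d + 1) → Fin d → ℝ =>
      ENNReal.ofReal (|(Matrix.of fun i j : Fin d => X i.succ j - X 0 j).det| ^ κ) *
        ∏ i, ENNReal.ofReal (Real.exp (-(t i * (X i ⬝ᵥ X i)))) :=
    (measurable_abs_det_rpow (by fun_prop) κ).mul (by unfold dotProduct; fun_prop)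
  have hmG : Measurable fun B : Fin d → Fin (d + 1) → ℝ =>
      ENNReal.ofReal (|(Matrix.of (Fin.cons s B :
        Fin (d + 1) → Fin (d + 1) → ℝ)).det| ^ κ) * ∏ j, gaussianWeight (B j) :=
    (measurable_abs_det_rpow (measurable_cons_const _) κ).mul (by fun_prop)
  have hG := lintegral_comp_mulVec (P := Matrix.diagonal s) (by rw [hPdet]; exact hsprod.ne') hmG
  rw [lintegral_det_cons, hPdet, abs_of_pos hsprod] at hG
  have hss : s ⬝ᵥ s = ∑ i, t i := by
    simp [s, dotProduct, Real.mul_self_sqrt (ht _).le]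
  have hpow : ENNReal.ofReal ((∏ i, s i)⁻¹ ^ κ) * ENNReal.ofReal ((∏ i, s i)⁻¹ ^ d) =
      ∏ i, ENNReal.ofReal (t i ^ (-((d + κ) / 2))) := by
    rw [← ENNReal.ofReal_prod_of_nonneg fun i _ => Real.rpow_nonneg (ht i).le _,
      ← ENNReal.ofReal_mul (by positivity), ← Real.rpow_natCast, ← Real.rpow_add (by positivity),
      ← Finset.prod_inv_distrib, ← Real.finsetProd_rpow _ _ fun i _ => by
        have := hs i
        positivity]
    congr 1
    refine Finset.prod_congr rfl fun i _ => ?_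
    simp only [s]
    rw [Real.sqrt_eq_rpow, ← Real.rpow_neg (ht i).le, ← Real.rpow_mul (ht i).le]
    congr 1
    ring
  rw [← lintegral_swap_index hmX, ← hpow]
  have hsum : ENNReal.ofReal (Real.sqrt (s ⬝ᵥ s) ^ κ) = ENNReal.ofReal ((∑ i, t i) ^ (κ / 2)) := by
    rw [hss, Real.sqrt_eq_rpow, ← Real.rpow_mul (Finset.sum_nonneg fun i _ => (ht i).le)]
    congr 2
    ring
  rw [hsum] at hG
  rw [mul_assoc, mul_assoc, ← hG, ← lintegral_const_mul']
  swap
  · exact ENNReal.ofReal_ne_top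
  refine lintegral_congr fun A => ?_
  rw [← mul_assoc, ← ENNReal.ofReal_mul (by positivity)]
  congr 1
  · have hmul : (Matrix.of (Fin.cons s fun j => (Matrix.diagonal s).mulVec (A j) :
        Fin (d + 1) → Fin (d + 1) → ℝ)) =
        (Matrix.of (Fin.cons 1 A : Fin (d + 1) → Fin (d + 1) → ℝ)) * Matrix.diagonal s := by
      ext i j
      refine Fin.cases ?_ (fun i => ?_) i <;> simp [Matrix.mulVec_diagonal, mul_comm]
    rw [hmul, Matrix.det_mul, hPdet, det_of_cons_one, abs_mul, abs_of_pos hsprod,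
      ← Real.mul_rpow (by positivity) (by positivity)]
    congr 2
    field_simp
  · rw [prod_gaussianWeight, ← ENNReal.ofReal_prod_of_nonneg fun _ _ => Real.exp_nonneg _,
      ← Real.exp_sum, Finset.sum_neg_distrib, Finset.sum_comm]
    congr 3
    refine Finset.sum_congr rfl fun i _ => ?_
    rw [dotProduct, Finset.mul_sum]
    refine Finset.sum_congr rfl fun j _ => ?_
    simp only [s]
    rw [Matrix.mulVec_diagonal, mul_pow, Real.sq_sqrt (ht i).le]
    ring

theorem prod_one_add_rpow_neg_eq_lintegral {n : ℕ} {β : ℝ} (hβ : 0 < β) {q : Fin n → ℝ}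
    (hq : ∀ i, 0 ≤ q i) :
    ENNReal.ofReal (Real.Gamma β ^ n) * ∏ i, ENNReal.ofReal ((1 + q i) ^ (-β)) =
      ∫⁻ t, ∏ i, ENNReal.ofReal (t i ^ (β - 1) * Real.exp (-((1 + q i) * t i)))
        ∂(Measure.pi fun _ : Fin n => volume.restrict (Set.Ioi (0 : ℝ))) := by
  rw [lintegral_pi_fin_prod (volume.restrict (Set.Ioi (0 : ℝ)))
    (f := fun i x => ENNReal.ofReal (x ^ (β - 1) * Real.exp (-((1 + q i) * x))))
    (fun _ => by fun_prop)]
  have h i := lintegral_rpow_mul_exp_neg_mul hβ (by linarith [hq i] : 0 < 1 + q i)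
  simp_rw [h, ENNReal.ofReal_mul' (Real.Gamma_pos_of_pos hβ).le]
  rw [Finset.prod_mul_distrib, Finset.prod_const, Finset.card_univ, Fintype.card_fin, mul_comm,
    ENNReal.ofReal_pow (Real.Gamma_pos_of_pos hβ).le]

theorem lintegral_betaPrime_simplex {d : ℕ} {β κ : ℝ} (hκ0 : 0 ≤ κ) (hκ : κ < 2 * β - d) :
    ENNReal.ofReal (Real.Gamma β ^ (d + 1)) * ∫⁻ X : Fin (d + 1) → Fin d → ℝ,
      ENNReal.ofReal (|(Matrix.of fun i j : Fin d => X i.succ j - X 0 j).det| ^ κ) *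
        ∏ i, ENNReal.ofReal ((1 + X i ⬝ᵥ X i) ^ (-β)) =
      ENNReal.ofReal (Real.Gamma (β - (d + κ) / 2) ^ (d + 1) *
        Real.Gamma ((d + 1) * (β - (d + κ) / 2) + κ / 2) /
          Real.Gamma ((d + 1) * (β - (d + κ) / 2))) *
        (ENNReal.ofReal (Real.sqrt Real.pi ^ d) * gaussianDetMoment d κ) := by
  have hd0 : (0 : ℝ) ≤ d := d.cast_nonneg
  have hβ : 0 < β := by linarith
  have hdot (v : Fin d → ℝ) : 0 ≤ v ⬝ᵥ v := Finset.sum_nonneg fun i _ => mul_self_nonneg _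
  have hdet : Measurable fun X : Fin (d + 1) → Fin d → ℝ =>
      ENNReal.ofReal (|(Matrix.of fun i j : Fin d => X i.succ j - X 0 j).det| ^ κ) :=
    measurable_abs_det_rpow (by fun_prop) κ
  calc
    _ = ∫⁻ X : Fin (d + 1) → Fin d → ℝ,
        ∫⁻ t, ENNReal.ofReal (|(Matrix.of fun i j : Fin d => X i.succ j - X 0 j).det| ^ κ) *
          ∏ i, ENNReal.ofReal (t i ^ (β - 1) * Real.exp (-((1 + X i ⬝ᵥ X i) * t i)))
        ∂(Measure.pi fun _ : Fin (d + 1) => volume.restrict (Set.Ioi (0 : ℝ))) := by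
      rw [← lintegral_const_mul' _ _ ENNReal.ofReal_ne_top]
      refine lintegral_congr fun X => ?_
      rw [lintegral_const_mul _ (by fun_prop),
        ← prod_one_add_rpow_neg_eq_lintegral hβ fun i => hdot (X i), mul_left_comm]
    _ = ∫⁻ t, (∫⁻ X : Fin (d + 1) → Fin d → ℝ,
        ENNReal.ofReal (|(Matrix.of fun i j : Fin d => X i.succ j - X 0 j).det| ^ κ) *
          ∏ i, ENNReal.ofReal (t i ^ (β - 1) * Real.exp (-((1 + X i ⬝ᵥ X i) * t i))))
        ∂(Measure.pi fun _ : Fin (d + 1) => volume.restrict (Set.Ioi (0 : ℝ))) := by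
      refine lintegral_lintegral_swap (Measurable.aemeasurable ?_)
      refine (hdet.comp measurable_fst).mul ?_
      unfold dotProduct
      fun_prop
    _ = ∫⁻ t, (∏ i, ENNReal.ofReal (t i ^ (β - (d + κ) / 2 - 1) * Real.exp (-t i))) *
          ENNReal.ofReal ((∑ i, t i) ^ (κ / 2)) *
          (ENNReal.ofReal (Real.sqrt Real.pi ^ d) * gaussianDetMoment d κ)
        ∂(Measure.pi fun _ : Fin (d + 1) => volume.restrict (Set.Ioi (0 : ℝ))) := by
      rw [← Measure.restrict_pi_pi]
      refine setLIntegral_congr_fun (.univ_pi fun _ => measurableSet_Ioi) fun t ht => ?_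
      replace ht : ∀ i, 0 < t i := fun i => ht i trivial
      have hX (X : Fin (d + 1) → Fin d → ℝ) :
          ENNReal.ofReal (|(Matrix.of fun i j : Fin d => X i.succ j - X 0 j).det| ^ κ) *
            ∏ i, ENNReal.ofReal (t i ^ (β - 1) * Real.exp (-((1 + X i ⬝ᵥ X i) * t i))) =
          (∏ i, ENNReal.ofReal (t i ^ (β - 1) * Real.exp (-t i))) *
            (ENNReal.ofReal (|(Matrix.of fun i j : Fin d => X i.succ j - X 0 j).det| ^ κ) *
              ∏ i, ENNReal.ofReal (Real.exp (-(t i * (X i ⬝ᵥ X i))))) := by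
        rw [mul_left_comm, ← Finset.prod_mul_distrib]
        congr 1
        refine Finset.prod_congr rfl fun i _ => ?_
        rw [← ENNReal.ofReal_mul' (Real.exp_nonneg _), mul_assoc, ← Real.exp_add]
        congr 3
        ring
      simp_rw [hX]
      rw [lintegral_const_mul' _ _ (ENNReal.prod_ne_top fun _ _ => ENNReal.ofReal_ne_top),
        lintegral_simplex_det ht]
      simp only [← mul_assoc, ← Finset.prod_mul_distrib]
      congr 3
      refine Finset.prod_congr rfl fun i _ => ?_
      rw [← ENNReal.ofReal_mul' (Real.rpow_nonneg (ht i).le _), mul_right_comm,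
        ← Real.rpow_add (ht i)]
      ring_nf
    _ = _ := by
      rw [lintegral_mul_const _ (by fun_prop),
        lintegral_pi_prod_rpow_exp_mul_sum_rpow (by linarith) (by positivity)]

/-- Miles' formula: moments of the volume of the random simplex spanned by `d+1`
i.i.d. beta'-distributed points in `ℝ^d`. -/
theorem betaPrime_simplex_moments (d : ℕ) (hd : 1 ≤ d) (β : ℝ) (hβ : (d : ℝ) / 2 < β)
    (κ : ℝ) (hκ0 : 0 ≤ κ) (hκ : κ < 2 * β - d) :
    ∫ X : Fin (d + 1) → EuclideanSpace ℝ (Fin d),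
      (|(Matrix.of fun i j : Fin d => X i.succ j - X 0 j).det| / (Nat.factorial d : ℝ)) ^ κ *
        ∏ i : Fin (d + 1),
          ((Real.Gamma β / (Real.pi ^ ((d : ℝ) / 2) * Real.Gamma (β - (d : ℝ) / 2))) *
            (1 + ‖X i‖ ^ 2) ^ (-β))
    = ((Nat.factorial d : ℝ)) ^ (-κ) *
        (Real.Gamma ((β - (d : ℝ) / 2) * ((d : ℝ) + 1) - (d : ℝ) * κ / 2) /
          Real.Gamma ((β - ((d : ℝ) + κ) / 2) * ((d : ℝ) + 1))) *
        (Real.Gamma (β - ((d : ℝ) + κ) / 2) / Real.Gamma (β - (d : ℝ) / 2)) ^ (d + 1) *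
        ∏ i ∈ Finset.Icc 1 d,
          Real.Gamma (((i : ℝ) + κ) / 2) / Real.Gamma ((i : ℝ) / 2) := by
  have hd0 : (0 : ℝ) ≤ d := d.cast_nonneg
  have hβ0 : 0 < β := by linarith
  have ha : 0 < β - (d + κ) / 2 := by linarith
  have hb : 0 < β - (d : ℝ) / 2 := by linarith
  have hΓ := Real.Gamma_pos_of_pos hβ0
  have hdot (v : Fin d → ℝ) : 0 ≤ v ⬝ᵥ v := Finset.sum_nonneg fun i _ => mul_self_nonneg _
  have hnorm (x : EuclideanSpace ℝ (Fin d)) : ‖x‖ ^ 2 = x.ofLp ⬝ᵥ x.ofLp := by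
    simp [EuclideanSpace.real_norm_sq_eq, dotProduct, ← pow_two]
  have hsqrt : Real.sqrt Real.pi ^ d * Real.sqrt Real.pi ^ (d * d) =
      (Real.pi ^ ((d : ℝ) / 2)) ^ (d + 1) := by
    rw [Real.sqrt_eq_rpow, ← pow_add, ← Real.rpow_natCast, ← Real.rpow_natCast,
      ← Real.rpow_mul Real.pi_pos.le, ← Real.rpow_mul Real.pi_pos.le]
    congr 1
    push_cast
    ring
  let f : (Fin (d + 1) → Fin d → ℝ) → ℝ := fun X =>
    |(Matrix.of fun i j : Fin d => X i.succ j - X 0 j).det| ^ κ *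
      ∏ i, (1 + X i ⬝ᵥ X i) ^ (-β)
  have hf0 X : 0 ≤ f X := mul_nonneg (by positivity) <|
    Finset.prod_nonneg fun i _ => Real.rpow_nonneg (by linarith [hdot (X i)]) _
  have hofReal X : ENNReal.ofReal (f X) =
      ENNReal.ofReal (|(Matrix.of fun i j : Fin d => X i.succ j - X 0 j).det| ^ κ) *
        ∏ i, ENNReal.ofReal ((1 + X i ⬝ᵥ X i) ^ (-β)) := by
    rw [ENNReal.ofReal_mul (by positivity), ENNReal.ofReal_prod_of_nonneg]
    exact fun i _ => Real.rpow_nonneg (by linarith [hdot (X i)]) _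
  have hfm : Measurable f := by
    have h : Measurable fun X => ENNReal.ofReal (f X) := by
      simp_rw [hofReal]
      exact (measurable_abs_det_rpow (by fun_prop) κ).mul (by unfold dotProduct; fun_prop)
    simpa only [ENNReal.toReal_ofReal (hf0 _)] using h.ennreal_toReal
  have hmain : Real.Gamma β ^ (d + 1) * ∫ X, f X =
      Real.Gamma (β - (d + κ) / 2) ^ (d + 1) *
        Real.Gamma ((d + 1) * (β - (d + κ) / 2) + κ / 2) /
          Real.Gamma ((d + 1) * (β - (d + κ) / 2)) *
        (Real.sqrt Real.pi ^ d * (Real.sqrt Real.pi ^ (d * d) *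
          ∏ i ∈ Finset.Icc 1 d, Real.Gamma ((i + κ) / 2) / Real.Gamma ((i : ℝ) / 2))) := by
    have h := lintegral_betaPrime_simplex hκ0 hκ
    simp_rw [← hofReal] at h
    rw [gaussianDetMoment_eq d hκ0, ← ENNReal.ofReal_mul (by positivity),
      ← ENNReal.ofReal_mul (by positivity)] at h
    have h2 := congrArg ENNReal.toReal h
    rw [ENNReal.toReal_mul, ENNReal.toReal_ofReal (by positivity),
      ENNReal.toReal_ofReal (by positivity)] at h2
    rw [integral_eq_lintegral_of_nonneg_ae (.of_forall hf0) hfm.aestronglyMeasurable, h2]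
  have hmp : MeasurePreserving fun (X : Fin (d + 1) → EuclideanSpace ℝ (Fin d)) i =>
      MeasurableEquiv.toLp 2 (Fin d → ℝ) |>.symm (X i) :=
    volume_preserving_pi fun _ => PiLp.volume_preserving_ofLp (Fin d)
  have htransfer : ∫ X : Fin (d + 1) → EuclideanSpace ℝ (Fin d), f (fun i => (X i).ofLp) =
      ∫ X, f X :=
    hmp.integral_comp (MeasurableEquiv.piCongrRight fun _ : Fin (d + 1) =>
      (MeasurableEquiv.toLp 2 (Fin d → ℝ)).symm).measurableEmbedding f
  calc
    _ = ∫ X : Fin (d + 1) → EuclideanSpace ℝ (Fin d), ((Nat.factorial d : ℝ) ^ (-κ) *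
        (Real.Gamma β / (Real.pi ^ ((d : ℝ) / 2) * Real.Gamma (β - (d : ℝ) / 2))) ^ (d + 1)) *
          f (fun i => (X i).ofLp) := by
      refine integral_congr_ae (.of_forall fun X => ?_)
      simp only [f, hnorm]
      rw [Finset.prod_mul_distrib, Finset.prod_const, Finset.card_univ, Fintype.card_fin,
        Real.div_rpow (abs_nonneg _) (by positivity), Real.rpow_neg (by positivity)]
      ring
    _ = _ := by
      rw [integral_const_mul, htransfer, div_pow, mul_pow, ← hsqrt,
        show (β - (d : ℝ) / 2) * (d + 1) - d * κ / 2 =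
          (d + 1) * (β - (d + κ) / 2) + κ / 2 by ring, mul_comm (β - (d + κ) / 2) ((d : ℝ) + 1)]
      have hπ := Real.sqrt_pos.2 Real.pi_pos
      have hI : ∫ X, f X = _ := eq_div_of_mul_eq (by positivity) ((mul_comm _ _).trans hmain)
      rw [hI, div_pow]
      have := Real.Gamma_pos_of_pos hb
      have : 0 < Real.Gamma ((d + 1) * (β - (d + κ) / 2)) := by positivity
      field_simp
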